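/- Let k ≥ 3 and n ≥ ⌈8k/3⌉ be integers and let F ⊆ \binom{[n]}{k} be an intersecting family. Then the ⌈8k/3⌉-th largest degree satisfies d_{⌈8k/3⌉}(F) ≤ \binom{n-2}{k-2}. -/

import Mathlib

open Finset

/-- The degree of `x` in the family `F`: the number of members of `F` containing `x`. -/
def degree (F : Finset (Finset ℕ)) (x : ℕ) : ℕ :=
  (F.filter fun A => x ∈ A).card

/-- The `i`-th largest degree (1-indexed) of the family `F` on ground set `[n] = {1, …, n}`:
the `i`-th entry of the list of degrees of all `n` elements arranged in nonincreasing order. -/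
def nthDegree (n : ℕ) (F : Finset (Finset ℕ)) (i : ℕ) : ℕ :=
  (((Finset.Icc 1 n).val.map (degree F)).sort (· ≥ ·)).getD (i - 1) 0


/-- all `s`-subsets of members of the family -/
def shd {α : Type*} [DecidableEq α] (s : ℕ) (𝒜 : Finset (Finset α)) : Finset (Finset α) :=
  𝒜.biUnion (powersetCard s)

lemma mem_shd {α : Type*} [DecidableEq α] {s : ℕ} {𝒜 : Finset (Finset α)} {B : Finset α} :
    B ∈ shd s 𝒜 ↔ ∃ A ∈ 𝒜, B ⊆ A ∧ #B = s := by
  simp [shd, mem_powersetCard]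

lemma shd_mono {α : Type*} [DecidableEq α] {s : ℕ} {𝒜 ℬ : Finset (Finset α)} (h : 𝒜 ⊆ ℬ) :
    shd s 𝒜 ⊆ shd s ℬ := biUnion_subset_biUnion_of_subset_left _ h

lemma shd_subset {α : Type*} [DecidableEq α] {s r : ℕ} {𝒜 : Finset (Finset α)} {X : Finset α}
    (h : 𝒜 ⊆ powersetCard r X) : shd s 𝒜 ⊆ powersetCard s X := by
  intro B hB
  obtain ⟨A, hA, hBA, hc⟩ := mem_shd.1 hB
  exact mem_powersetCard.2 ⟨hBA.trans (mem_powersetCard.1 (h hA)).1, hc⟩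

lemma lym {α : Type*} [DecidableEq α] {r s : ℕ} {X : Finset α} {𝒜 : Finset (Finset α)}
    (h : 𝒜 ⊆ powersetCard r X) (hs : s ≤ r) :
    #𝒜 * (#X).choose s ≤ #(shd s 𝒜) * (#X).choose r := by
  by_cases hr : r ≤ #X
  swap
  · have : 𝒜 = ∅ := by
      apply subset_empty.1
      rw [← powersetCard_eq_empty.2 (not_le.1 hr)]
      exact h
    simp [this]
  have key : #𝒜 * r.choose s ≤ #(shd s 𝒜) * (#X - s).choose (r - s) := by
    classical
    apply card_mul_le_card_mul (fun A B => B ⊆ A)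
    · intro A hA
      have : powersetCard s A ⊆ bipartiteAbove (fun A B => B ⊆ A) (shd s 𝒜) A := by
        intro B hB
        rw [mem_powersetCard] at hB
        simp only [bipartiteAbove, mem_filter]
        exact ⟨mem_shd.2 ⟨A, hA, hB.1, hB.2⟩, hB.1⟩
      have h2 := card_le_card this
      rwa [card_powersetCard, (mem_powersetCard.1 (h hA)).2] at h2
    · intro B hB
      have hBX := mem_powersetCard.1 (shd_subset h hB)
      have : #(X \ B) = #X - s := by rw [card_sdiff_of_subset hBX.1, hBX.2]
      rw [← this, ← card_powersetCard]
      apply card_le_card_of_injOn (fun A => A \ B)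
      · intro A hA
        simp only [bipartiteBelow, coe_filter, Set.mem_ofPred_eq] at hA
        have hAX := mem_powersetCard.1 (h hA.1)
        simp only [mem_coe, mem_powersetCard]
        exact ⟨sdiff_subset_sdiff hAX.1 le_rfl, by rw [card_sdiff_of_subset hA.2, hAX.2, hBX.2]⟩
      · intro A hA A' hA' he
        simp only [bipartiteBelow, coe_filter, Set.mem_ofPred_eq] at hA hA'
        have := congrArg (fun Z => B ∪ Z) he
        simpa [union_sdiff_of_subset hA.2, union_sdiff_of_subset hA'.2] using this
  have h3 : (#X).choose r * r.choose s = (#X).choose s * (#X - s).choose (r - s) :=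
    Nat.choose_mul hs
  have h4 : 0 < (#X - s).choose (r - s) := Nat.choose_pos (by omega)
  apply Nat.le_of_mul_le_mul_right _ h4
  calc #𝒜 * (#X).choose s * (#X - s).choose (r - s) = (#𝒜 * r.choose s) * (#X).choose r := by
        rw [mul_assoc, ← h3]; ring
    _ ≤ (#(shd s 𝒜) * (#X - s).choose (r - s)) * (#X).choose r := Nat.mul_le_mul_right _ key
    _ = _ := by ring

lemma shd_eq_shadow {α : Type*} [DecidableEq α] {r s : ℕ} {𝒜 : Finset (Finset α)}
    (h : (𝒜 : Set (Finset α)).Sized r) (hs : s ≤ r) : shd s 𝒜 = (shadow^[r - s] 𝒜) := by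
  ext B
  rw [mem_shd, mem_shadow_iterate_iff_exists_sdiff]
  constructor
  · rintro ⟨A, hA, hBA, hc⟩
    exact ⟨A, hA, hBA, by rw [card_sdiff_of_subset hBA, hc, h hA]⟩
  · rintro ⟨A, hA, hBA, hc⟩
    refine ⟨A, hA, hBA, ?_⟩
    rw [card_sdiff_of_subset hBA, h hA] at hc
    have := card_le_card hBA
    rw [h hA] at this
    omega

def wk (N M : ℕ) : Finset (Fin N) := univ.filter fun i => i.val < M

lemma mem_wk {N M : ℕ} {i : Fin N} : i ∈ wk N M ↔ i.val < M := by simp [wk]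

lemma card_wk {N M : ℕ} (h : M ≤ N) : #(wk N M) = M := by
  simp [wk, Fin.card_filter_val_lt, h]

lemma initSeg_wk (N M r : ℕ) : Colex.IsInitSeg (powersetCard r (wk N M)) r := by
  refine ⟨Set.sized_powersetCard _ _, ?_⟩
  simp_rw [mem_powersetCard]
  rintro A B hA ⟨HB₁, HB₂⟩
  refine ⟨fun t ht ↦ ?_, ‹_›⟩
  rw [mem_wk]
  have : toColex (image Fin.val B) < toColex (image Fin.val A) := by
    rwa [Colex.toColex_image_lt_toColex_image Fin.val_strictMono]
  apply Colex.forall_lt_mono this.le _ t (mem_image.2 ⟨t, ht, rfl⟩)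
  simp_rw [mem_image]
  rintro _ ⟨a, ha, hab⟩
  have := mem_wk.1 (hA.1 ha)
  omega

lemma exists_initSeg (N r m : ℕ) (hm : m ≤ N.choose r) :
    ∃ 𝒞 : Finset (Finset (Fin N)), Colex.IsInitSeg 𝒞 r ∧ #𝒞 = m := by
  induction m with
  | zero => exact ⟨∅, by simp, by simp⟩
  | succ m ih =>
    obtain ⟨𝒞, h𝒞, hc⟩ := ih (by omega)
    have hsub : 𝒞 ⊆ powersetCard r univ := fun A hA => mem_powersetCard.2 ⟨subset_univ _, h𝒞.1 hA⟩
    have hne : (powersetCard r univ \ 𝒞).Nonempty := by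
      rw [← card_pos, card_sdiff_of_subset hsub, card_powersetCard, card_univ, Fintype.card_fin]
      omega
    obtain ⟨A, hA, hmin⟩ := exists_min_image _ (fun A => toColex A) hne
    rw [mem_sdiff, mem_powersetCard] at hA
    refine ⟨insert A 𝒞, ⟨?_, ?_⟩, ?_⟩
    · intro B hB
      rw [coe_insert, Set.mem_insert_iff] at hB
      rcases hB with rfl | hB
      · exact hA.1.2
      · exact h𝒞.1 hB
    · intro B C hB hC
      rw [mem_insert] at hB ⊢
      by_contra hcon
      push Not at hcon
      have h1 := hmin C (mem_sdiff.2 ⟨mem_powersetCard.2 ⟨subset_univ _, hC.2⟩, hcon.2⟩)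
      rcases hB with rfl | hB
      · exact absurd h1 (not_le.2 hC.1)
      · exact hcon.2 (h𝒞.2 hB hC)
    · rw [card_insert_of_notMem hA.2, hc]

lemma exists_seg_shd {N r s : ℕ} {𝒜 : Finset (Finset (Fin N))}
    (h : (𝒜 : Set (Finset (Fin N))).Sized r) (hs : s ≤ r) :
    ∃ 𝒞 : Finset (Finset (Fin N)), Colex.IsInitSeg 𝒞 r ∧ #𝒞 = #𝒜 ∧
      #(shd s 𝒞) ≤ #(shd s 𝒜) := by
  have hm : #𝒜 ≤ N.choose r := by simpa using h.card_le
  obtain ⟨𝒞, h𝒞, hc⟩ := exists_initSeg N r _ hm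
  refine ⟨𝒞, h𝒞, hc, ?_⟩
  rw [shd_eq_shadow h hs, shd_eq_shadow h𝒞.1 hs]
  exact iterated_kk h hc.le h𝒞

lemma sub_wk {N M r : ℕ} {𝒞 : Finset (Finset (Fin N))} (h : Colex.IsInitSeg 𝒞 r) (hM : M ≤ N)
    (hc : #𝒞 ≤ M.choose r) : 𝒞 ⊆ powersetCard r (wk N M) := by
  rcases h.total (initSeg_wk N M r) with h1 | h1
  · exact h1
  · exact (eq_of_subset_of_card_le h1 (by simpa [card_wk hM] using hc)).symm.subset

lemma wk_sub {N M r : ℕ} {𝒞 : Finset (Finset (Fin N))} (h : Colex.IsInitSeg 𝒞 r) (hM : M ≤ N)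
    (hc : M.choose r ≤ #𝒞) : powersetCard r (wk N M) ⊆ 𝒞 := by
  rcases h.total (initSeg_wk N M r) with h1 | h1
  · exact (eq_of_subset_of_card_le h1 (by simpa [card_wk hM] using hc)).symm.subset
  · exact h1

lemma shd_powersetCard {α : Type*} [DecidableEq α] {r s : ℕ} {X : Finset α} (hs : s ≤ r)
    (hr : r ≤ #X) : shd s (powersetCard r X) = powersetCard s X := by
  apply Subset.antisymm (shd_subset le_rfl)
  intro B hB
  rw [mem_powersetCard] at hB
  obtain ⟨C, h1, h2, h3⟩ := exists_subsuperset_card_eq hB.1 (by omega : #B ≤ r) hr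
  exact mem_shd.2 ⟨C, mem_powersetCard.2 ⟨h2, h3⟩, h1, hB.2⟩

lemma lovasz_fin {N r s M : ℕ} {𝒜 : Finset (Finset (Fin N))}
    (h : (𝒜 : Set (Finset (Fin N))).Sized r) (hs : s ≤ r) (hr : r ≤ M) (hM : M ≤ N)
    (hc : M.choose r ≤ #𝒜) : M.choose s ≤ #(shd s 𝒜) := by
  obtain ⟨𝒞, h𝒞, hcard, hle⟩ := exists_seg_shd h hs
  refine le_trans ?_ hle
  have := card_le_card (shd_mono (s := s) (wk_sub h𝒞 hM (hcard ▸ hc)))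
  rwa [shd_powersetCard hs (by rwa [card_wk hM]), card_powersetCard, card_wk hM] at this

lemma k1_fin {N r s M : ℕ} {𝒜 : Finset (Finset (Fin N))}
    (h : (𝒜 : Set (Finset (Fin N))).Sized r) (hs : s ≤ r) (hM : M ≤ N)
    (hc : #𝒜 ≤ M.choose r) : #𝒜 * M.choose s ≤ #(shd s 𝒜) * M.choose r := by
  obtain ⟨𝒞, h𝒞, hcard, hle⟩ := exists_seg_shd h hs
  have := lym (sub_wk h𝒞 hM (hcard ▸ hc)) hs
  rw [card_wk hM, hcard] at this
  exact this.trans (Nat.mul_le_mul_right _ hle)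

lemma k2_fin {N r s M : ℕ} {𝒜 : Finset (Finset (Fin N))}
    (h : (𝒜 : Set (Finset (Fin N))).Sized (r+1)) (hs : s ≤ r) (hr : r + 1 ≤ M) (hM : M + 1 ≤ N)
    (hc : M.choose (r+1) ≤ #𝒜) (hc2 : #𝒜 ≤ (M+1).choose (r+1)) :
    (#𝒜 - M.choose (r+1)) * M.choose s ≤ (#(shd (s+1) 𝒜) - M.choose (s+1)) * M.choose r := by
  obtain ⟨𝒞, h𝒞, hcard, hle⟩ := exists_seg_shd h (show s + 1 ≤ r + 1 by omega)
  rw [← hcard] at hc hc2 ⊢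
  refine le_trans ?_ (Nat.mul_le_mul_right _ (Nat.sub_le_sub_right hle _))
  have h1 := wk_sub h𝒞 (by omega) hc
  have h2 := sub_wk h𝒞 hM hc2
  let z : Fin N := ⟨M, by omega⟩
  have hz : z ∉ wk N M := by simp [mem_wk, z]
  have hw : wk N (M+1) = insert z (wk N M) := by
    ext i
    simp only [mem_wk, mem_insert, Fin.ext_iff, z]
    omega
  -- the link of z
  let 𝒟 := (𝒞.filter (fun A => z ∈ A)).image (fun A => A.erase z)
  have hD : 𝒟 ⊆ powersetCard r (wk N M) := by
    intro B hB
    obtain ⟨A, hA, rfl⟩ := mem_image.1 hB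
    rw [mem_filter] at hA
    have := mem_powersetCard.1 (h2 hA.1)
    rw [mem_powersetCard, card_erase_of_mem hA.2, this.2, hw] at *
    exact ⟨fun i hi => (mem_insert.1 (this.1 (mem_of_mem_erase hi))).resolve_left
      (ne_of_mem_erase hi), rfl⟩
  have hDc : #𝒟 = #𝒞 - M.choose (r+1) := by
    have e1 : 𝒞.filter (fun A => z ∈ A) = 𝒞 \ powersetCard (r+1) (wk N M) := by
      ext A
      simp only [mem_filter, mem_sdiff, mem_powersetCard, not_and]
      refine and_congr_right fun hA => ?_
      have := mem_powersetCard.1 (h2 hA)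
      rw [hw] at this
      constructor
      · intro hzA hsub
        exact absurd (hsub hzA) hz
      · intro hcon
        by_contra hzA
        exact hcon (fun i hi => (mem_insert.1 (this.1 hi)).resolve_left
          (by rintro rfl; exact hzA hi)) this.2
    have e2 : #𝒟 = #(𝒞.filter (fun A => z ∈ A)) := by
      apply card_image_of_injOn
      intro A hA A' hA' he
      simp only [coe_filter, Set.mem_ofPred_eq] at hA hA'
      have := congrArg (insert z) he
      simpa [insert_erase hA.2, insert_erase hA'.2] using this
    rw [e2, e1, card_sdiff_of_subset h1, card_powersetCard, card_wk (by omega)]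
  have hl := lym hD hs
  rw [card_wk (by omega), hDc] at hl
  refine hl.trans (Nat.mul_le_mul_right _ ?_)
  have hsub : powersetCard (s+1) (wk N M) ∪ (shd s 𝒟).image (insert z) ⊆ shd (s+1) 𝒞 := by
    apply union_subset
    · rw [← shd_powersetCard (show s + 1 ≤ r + 1 by omega) (by rwa [card_wk (by omega)])]
      exact shd_mono h1
    · intro B hB
      obtain ⟨B', hB', rfl⟩ := mem_image.1 hB
      have hB2 := mem_powersetCard.1 (shd_subset hD hB')
      obtain ⟨A', hA', hBA, hc⟩ := mem_shd.1 hB'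
      obtain ⟨A, hA, rfl⟩ := mem_image.1 hA'
      rw [mem_filter] at hA
      refine mem_shd.2 ⟨A, hA.1, insert_subset hA.2 (hBA.trans (erase_subset _ _)), ?_⟩
      rw [card_insert_of_notMem (fun h => hz (hB2.1 h)), hc]
  have hcc := card_le_card hsub
  rw [card_union_of_disjoint, card_powersetCard, card_wk (by omega), card_image_of_injOn] at hcc
  · omega
  · intro A hA A' hA' he
    have hA := mem_powersetCard.1 (shd_subset hD hA)
    have hA' := mem_powersetCard.1 (shd_subset hD hA')
    have := congrArg (fun Z => Z.erase z) he
    simpa [erase_insert (fun h => hz (hA.1 h)), erase_insert (fun h => hz (hA'.1 h))] using this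
  · rw [disjoint_left]
    intro A hA hA'
    obtain ⟨B', hB', rfl⟩ := mem_image.1 hA'
    exact hz ((mem_powersetCard.1 hA).1 (mem_insert_self _ _))

/-- transport to `Fin` -/
lemma transport {α : Type*} [DecidableEq α] {r : ℕ} {X : Finset α} {𝒜 : Finset (Finset α)}
    (h : 𝒜 ⊆ powersetCard r X) : ∃ ℬ : Finset (Finset (Fin #X)),
      (ℬ : Set (Finset (Fin #X))).Sized r ∧ #ℬ = #𝒜 ∧ ∀ s, #(shd s ℬ) = #(shd s 𝒜) := by
  let e : Fin #X ↪ α := (X.equivFin.symm.toEmbedding).trans (Function.Embedding.subtype _)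
  have he : ∀ x ∈ X, ∃ i, e i = x := fun x hx => ⟨X.equivFin ⟨x, hx⟩, by simp [e]⟩
  have heX : ∀ i, e i ∈ X := fun i => by simp [e]
  let φ : Finset (Fin #X) → Finset α := fun B => B.map e
  have hφ : Function.Injective φ := fun A B hAB => by simpa [φ] using hAB
  have hsur : ∀ A ⊆ X, ∃ B, φ B = A := by
    intro A hA
    refine ⟨univ.filter (fun i => e i ∈ A), ?_⟩
    ext x
    simp only [φ, mem_map, mem_filter, mem_univ, true_and]
    constructor
    · rintro ⟨i, hi, rfl⟩; exact hi
    · intro hx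
      obtain ⟨i, rfl⟩ := he x (hA hx)
      exact ⟨i, hx, rfl⟩
  let ℬ := (univ : Finset (Finset (Fin #X))).filter (fun B => φ B ∈ 𝒜)
  have hB : ∀ B, B ∈ ℬ ↔ φ B ∈ 𝒜 := fun B => by simp [ℬ]
  have him : ℬ.image φ = 𝒜 := by
    ext A
    rw [mem_image]
    constructor
    · rintro ⟨B, hB1, rfl⟩; exact (hB B).1 hB1
    · intro hA
      obtain ⟨B, rfl⟩ := hsur A (mem_powersetCard.1 (h hA)).1
      exact ⟨B, (hB B).2 hA, rfl⟩
  refine ⟨ℬ, ?_, ?_, ?_⟩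
  · intro B hB1
    have := (mem_powersetCard.1 (h ((hB B).1 hB1))).2
    simpa [φ] using this
  · rw [← him, card_image_of_injective _ hφ]
  · intro s
    rw [← card_image_of_injective _ hφ]
    congr 1
    ext C
    rw [mem_image, mem_shd]
    constructor
    · rintro ⟨B, hB1, rfl⟩
      obtain ⟨A, hA, hBA, hc⟩ := mem_shd.1 hB1
      exact ⟨φ A, (hB A).1 hA, by simpa [φ] using hBA, by simpa [φ] using hc⟩
    · rintro ⟨A, hA, hCA, hc⟩
      have hAX := (mem_powersetCard.1 (h hA)).1
      obtain ⟨A', rfl⟩ := hsur A hAX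
      obtain ⟨C', rfl⟩ := hsur C (hCA.trans hAX)
      exact ⟨C', mem_shd.2 ⟨A', (hB _).2 hA, by simpa [φ] using hCA, by simpa [φ] using hc⟩, rfl⟩

lemma lovasz {α : Type*} [DecidableEq α] {r s M : ℕ} {X : Finset α} {𝒜 : Finset (Finset α)}
    (h : 𝒜 ⊆ powersetCard r X) (hs : s ≤ r) (hr : r ≤ M) (hM : M ≤ #X)
    (hc : M.choose r ≤ #𝒜) : M.choose s ≤ #(shd s 𝒜) := by
  obtain ⟨ℬ, h1, h2, h3⟩ := transport h
  rw [← h3]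
  exact lovasz_fin h1 hs hr hM (h2 ▸ hc)

lemma k1 {α : Type*} [DecidableEq α] {r s M : ℕ} {X : Finset α} {𝒜 : Finset (Finset α)}
    (h : 𝒜 ⊆ powersetCard r X) (hs : s ≤ r) (hM : M ≤ #X)
    (hc : #𝒜 ≤ M.choose r) : #𝒜 * M.choose s ≤ #(shd s 𝒜) * M.choose r := by
  obtain ⟨ℬ, h1, h2, h3⟩ := transport h
  rw [← h3, ← h2]
  exact k1_fin h1 hs hM (h2 ▸ hc)

lemma k2 {α : Type*} [DecidableEq α] {r s M : ℕ} {X : Finset α} {𝒜 : Finset (Finset α)}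
    (h : 𝒜 ⊆ powersetCard (r+1) X) (hs : s ≤ r) (hr : r + 1 ≤ M) (hM : M + 1 ≤ #X)
    (hc : M.choose (r+1) ≤ #𝒜) (hc2 : #𝒜 ≤ (M+1).choose (r+1)) :
    (#𝒜 - M.choose (r+1)) * M.choose s ≤ (#(shd (s+1) 𝒜) - M.choose (s+1)) * M.choose r := by
  obtain ⟨ℬ, h1, h2, h3⟩ := transport h
  rw [← h3, ← h2]
  exact k2_fin h1 hs hr hM (h2 ▸ hc) (h2 ▸ hc2)


lemma lemmaK_base {p σ : ℕ} {X : Finset ℕ} {𝒜 : Finset (Finset ℕ)}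
    (h : 𝒜 ⊆ powersetCard (p + 1 + σ) X) (hX : #X ≤ 2 * p + 1 + σ) :
    (p + 1 + σ) * #𝒜 ≤ (p + 1) * #(shd (p + 1) 𝒜) := by
  obtain ⟨Z, hXZ, hZ⟩ := Infinite.exists_superset_card_eq X _ hX
  have hl := lym (h.trans (powersetCard_mono hXZ)) (show p + 1 ≤ p + 1 + σ by omega)
  rw [hZ] at hl
  have h1 := Nat.choose_succ_right_eq (2 * p + 1 + σ) p
  have h2 : (2 * p + 1 + σ).choose (p + 1 + σ) = (2 * p + 1 + σ).choose p :=
    Nat.choose_symm_of_eq_add (by omega)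
  rw [show 2 * p + 1 + σ - p = p + 1 + σ by omega] at h1
  rw [h2] at hl
  have h3 : 0 < (2 * p + 1 + σ).choose p := Nat.choose_pos (by omega)
  apply Nat.le_of_mul_le_mul_right _ h3
  calc (p + 1 + σ) * #𝒜 * (2 * p + 1 + σ).choose p
      = (#𝒜 * (2 * p + 1 + σ).choose (p+1)) * (p + 1) := by rw [mul_assoc #𝒜, h1]; ring
    _ ≤ (#(shd (p+1) 𝒜) * (2 * p + 1 + σ).choose p) * (p + 1) := Nat.mul_le_mul_right _ hl
    _ = _ := by ring

lemma lemmaK (X : Finset ℕ) : ∀ (p σ : ℕ) (𝒜 : Finset (Finset ℕ)),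
    𝒜 ⊆ powersetCard (p + 1 + σ) X →
    (∀ S ∈ 𝒜, ∀ S' ∈ 𝒜, σ + 1 ≤ #(S ∩ S')) →
    (∀ S ∈ 𝒜, ∀ i ∈ S, ∀ j ∈ X, j ∉ S → i < j → insert j (S.erase i) ∈ 𝒜) →
    (p + 1 + σ) * #𝒜 ≤ (p + 1) * #(shd (p + 1) 𝒜) := by
  induction X using Finset.induction_on_min with
  | empty =>
    intro p σ 𝒜 h _ _
    exact lemmaK_base h (by simp)
  | insert z Y hz ih =>
    intro p σ 𝒜 h hint hcl
    by_cases hX : #(insert z Y) ≤ 2 * p + 1 + σ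
    · exact lemmaK_base h hX
    push Not at hX
    have hzY : z ∉ Y := fun hh => lt_irrefl _ (hz z hh)
    have hS : ∀ S ∈ 𝒜, S ⊆ insert z Y ∧ #S = p + 1 + σ := fun S hS => mem_powersetCard.1 (h hS)
    -- free swap
    have hswap : ∀ S ∈ 𝒜, ∀ S' ∈ 𝒜, z ∈ S → z ∈ S' → σ + 2 ≤ #(S ∩ S') := by
      intro S hSA S' hS'A hzS hzS'
      by_contra hcon
      have h1 := hint S hSA S' hS'A
      have h2 := card_union_add_card_inter S S'
      rw [(hS S hSA).2, (hS S' hS'A).2] at h2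
      have h3 : #(S ∪ S') < #(insert z Y) := by omega
      obtain ⟨y, hy, hyS⟩ := exists_mem_notMem_of_card_lt_card h3
      rw [mem_union, not_or] at hyS
      have hyz : z < y := by
        rcases mem_insert.1 hy with rfl | hy
        · exact absurd hzS hyS.1
        · exact hz y hy
      have h4 := hint _ (hcl S hSA z hzS y hy hyS.1 hyz) S' hS'A
      have h5 : insert y (S.erase z) ∩ S' = (S ∩ S').erase z := by
        ext x
        simp only [mem_inter, mem_insert, mem_erase]
        constructor
        · rintro ⟨rfl | hx, hx'⟩
          · exact absurd hx' hyS.2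
          · exact ⟨hx.1, hx.2, hx'⟩
        · rintro ⟨hx, hx1, hx2⟩
          exact ⟨Or.inr ⟨hx, hx1⟩, hx2⟩
      rw [h5, card_erase_of_mem (mem_inter.2 ⟨hzS, hzS'⟩)] at h4
      omega
    have hc := card_memberSubfamily_add_card_nonMemberSubfamily z 𝒜
    have I0 := ih p σ (𝒜.nonMemberSubfamily z) (by
        intro S hSA
        rw [mem_nonMemberSubfamily] at hSA
        have := hS S hSA.1
        exact mem_powersetCard.2 ⟨(subset_insert_iff_of_notMem hSA.2).1 this.1, this.2⟩)
      (fun S hS S' hS' => hint S (mem_nonMemberSubfamily.1 hS).1 S' (mem_nonMemberSubfamily.1 hS').1)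
      (by
        intro S hSA i hi j hj hjS hij
        rw [mem_nonMemberSubfamily] at hSA ⊢
        refine ⟨hcl S hSA.1 i hi j (mem_insert_of_mem hj) hjS hij, ?_⟩
        have := hz j hj
        simp only [mem_insert, mem_erase, not_or]
        exact ⟨by omega, fun hh => hSA.2 hh.2⟩)
    have hdis : #(shd (p+1) (𝒜.nonMemberSubfamily z)) + #(shd p (𝒜.memberSubfamily z)) ≤
        #(shd (p+1) 𝒜) := by
      have hsub : shd (p+1) (𝒜.nonMemberSubfamily z) ∪ 
          (shd p (𝒜.memberSubfamily z)).image (insert z) ⊆ shd (p+1) 𝒜 := by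
        apply union_subset
        · exact shd_mono (filter_subset _ _)
        · intro B hB
          obtain ⟨B', hB', rfl⟩ := mem_image.1 hB
          obtain ⟨A', hA', hBA, hc⟩ := mem_shd.1 hB'
          rw [mem_memberSubfamily] at hA'
          exact mem_shd.2 ⟨_, hA'.1, insert_subset_insert _ hBA, by
            rw [card_insert_of_notMem (fun hh => hA'.2 (hBA hh)), hc]⟩
      have hcc := card_le_card hsub
      rwa [card_union_of_disjoint, card_image_of_injOn] at hcc
      · intro A hA A' hA' he
        obtain ⟨C, hC, hAC, -⟩ := mem_shd.1 hA
        obtain ⟨C', hC', hAC', -⟩ := mem_shd.1 hA'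
        rw [mem_memberSubfamily] at hC hC'
        have := congrArg (fun Z => Z.erase z) he
        simpa [erase_insert (fun h => hC.2 (hAC h)), erase_insert (fun h => hC'.2 (hAC' h))] using this
      · rw [disjoint_left]
        intro A hA hA'
        obtain ⟨B', hB', rfl⟩ := mem_image.1 hA'
        obtain ⟨C, hC, hAC, -⟩ := mem_shd.1 hA
        exact (mem_nonMemberSubfamily.1 hC).2 (hAC (mem_insert_self _ _))
    have I1 : (p + 1 + σ) * #(𝒜.memberSubfamily z) ≤ (p + 1) * #(shd p (𝒜.memberSubfamily z)) := by
      rcases p with _ | p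
      · have : 𝒜.memberSubfamily z = ∅ := by
          apply eq_empty_of_forall_notMem
          intro S hSA
          rw [mem_memberSubfamily] at hSA
          have h1 := hswap _ hSA.1 _ hSA.1 (mem_insert_self _ _) (mem_insert_self _ _)
          rw [inter_self, (hS _ hSA.1).2] at h1
          omega
        simp [this]
      · have J := ih p σ (𝒜.memberSubfamily z) (by
            intro S hSA
            rw [mem_memberSubfamily] at hSA
            have := hS _ hSA.1
            rw [card_insert_of_notMem hSA.2] at this
            refine mem_powersetCard.2 ⟨?_, by omega⟩
            exact fun x hx => (mem_insert.1 (this.1 (mem_insert_of_mem hx))).resolve_left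
              (by rintro rfl; exact hSA.2 hx))
          (by
            intro S hSA S' hS'A
            rw [mem_memberSubfamily] at hSA hS'A
            have h1 := hswap _ hSA.1 _ hS'A.1 (mem_insert_self _ _) (mem_insert_self _ _)
            rw [← insert_inter_distrib, card_insert_of_notMem] at h1
            · omega
            · exact fun hh => hSA.2 (mem_inter.1 hh).1)
          (by
            intro S hSA i hi j hj hjS hij
            rw [mem_memberSubfamily] at hSA ⊢
            have hzj := hz j hj
            have hiz : i ≠ z := by rintro rfl; exact hSA.2 hi
            have := hcl _ hSA.1 i (mem_insert_of_mem hi) j (mem_insert_of_mem hj)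
              (by simp only [mem_insert, not_or]; exact ⟨by omega, hjS⟩) hij
            rw [erase_insert_of_ne hiz.symm, insert_comm] at this
            refine ⟨this, ?_⟩
            simp only [mem_insert, mem_erase, not_or]
            exact ⟨by omega, fun hh => hSA.2 hh.2⟩)
        have : (p+1) * ((p + 1 + 1 + σ) * #(𝒜.memberSubfamily z)) ≤
            (p+1) * ((p + 1 + 1) * #(shd (p+1) (𝒜.memberSubfamily z))) := by
          nlinarith [Nat.zero_le (σ * #(𝒜.memberSubfamily z)), Nat.zero_le #(𝒜.memberSubfamily z)]
        exact Nat.le_of_mul_le_mul_left this (by omega)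
    calc _ = (p + 1 + σ) * #(𝒜.memberSubfamily z) + (p + 1 + σ) * #(𝒜.nonMemberSubfamily z) := by
          rw [← hc]; ring
      _ ≤ (p + 1) * (#(shd (p+1) (𝒜.nonMemberSubfamily z)) + #(shd p (𝒜.memberSubfamily z))) := by
          rw [mul_add]; omega
      _ ≤ _ := Nat.mul_le_mul_left _ hdis


/-- elementary shift of one set -/
def mvs (i j : ℕ) (F : Finset (Finset ℕ)) (S : Finset ℕ) : Finset ℕ :=
  if j ∈ S ∧ i ∉ S ∧ insert i (S.erase j) ∉ F then insert i (S.erase j) else S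

def shf (i j : ℕ) (F : Finset (Finset ℕ)) : Finset (Finset ℕ) := F.image (mvs i j F)

lemma mvs_injOn (i j : ℕ) (F : Finset (Finset ℕ)) : Set.InjOn (mvs i j F) F := by
  intro S hS S' hS' he
  simp only [mem_coe] at hS hS'
  unfold mvs at he
  split_ifs at he with h1 h2 h2
  · have h3 : ∀ x, x ∈ insert i (S.erase j) ↔ x ∈ insert i (S'.erase j) := by rw [he]; simp
    ext x
    have := h3 x
    simp only [mem_insert, mem_erase] at this
    by_cases hxi : x = i
    · subst hxi; tauto
    · by_cases hxj : x = j
      · subst hxj; tauto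
      · tauto
  · exact absurd (he ▸ hS') h1.2.2
  · exact absurd (he ▸ hS) h2.2.2
  · exact he

lemma card_shf (i j : ℕ) (F : Finset (Finset ℕ)) : #(shf i j F) = #F :=
  card_image_of_injOn (mvs_injOn i j F)

lemma card_filter_shf_ge {i j : ℕ} {F : Finset (Finset ℕ)} (p q : Finset ℕ → Prop)
    [DecidablePred p] [DecidablePred q] (h : ∀ S ∈ F, p S → q (mvs i j F S)) :
    #(F.filter p) ≤ #((shf i j F).filter q) := by
  apply card_le_card_of_injOn (mvs i j F)
  · intro S hS
    simp only [coe_filter, Set.mem_ofPred_eq] at hS ⊢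
    exact ⟨mem_image_of_mem _ hS.1, h S hS.1 hS.2⟩
  · exact (mvs_injOn i j F).mono (by exact_mod_cast filter_subset p F)

lemma mem_mvs_of_ne {i j x : ℕ} {F : Finset (Finset ℕ)} {S : Finset ℕ} (hx : x ≠ j) (h : x ∈ S) :
    x ∈ mvs i j F S := by
  unfold mvs
  split_ifs
  · simp [hx, h]
  · exact h

lemma notMem_mvs_of_ne {i j x : ℕ} {F : Finset (Finset ℕ)} {S : Finset ℕ} (hx : x ≠ i)
    (h : x ∉ S) : x ∉ mvs i j F S := by
  unfold mvs
  split_ifs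
  · simp [hx, h]
  · exact h

lemma mvs_of_notMem {i j : ℕ} {F : Finset (Finset ℕ)} {S : Finset ℕ} (h : j ∉ S) :
    mvs i j F S = S := by
  unfold mvs
  simp [h]

lemma shf_subset {i j k : ℕ} {F : Finset (Finset ℕ)} {X : Finset ℕ} (hi : i ∈ X)
    (h : F ⊆ powersetCard k X) : shf i j F ⊆ powersetCard k X := by
  intro B hB
  obtain ⟨S, hS, rfl⟩ := mem_image.1 hB
  have hS' := mem_powersetCard.1 (h hS)
  unfold mvs
  split_ifs with h1
  · rw [mem_powersetCard]
    constructor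
    · exact insert_subset hi ((erase_subset _ _).trans hS'.1)
    · rw [card_insert_of_notMem (by simp [h1.2.1]), card_erase_of_mem h1.1, hS'.2]
      have : 0 < #S := card_pos.2 ⟨j, h1.1⟩
      omega
  · exact h hS

lemma shf_int {i j : ℕ} {F : Finset (Finset ℕ)}
    (h : ∀ A ∈ F, ∀ B ∈ F, (A ∩ B).Nonempty) :
    ∀ A ∈ shf i j F, ∀ B ∈ shf i j F, (A ∩ B).Nonempty := by
  have key : ∀ S ∈ F, ∀ S' ∈ F, (j ∈ S ∧ i ∉ S ∧ insert i (S.erase j) ∉ F) →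
      ¬ (j ∈ S' ∧ i ∉ S' ∧ insert i (S'.erase j) ∉ F) → (insert i (S.erase j) ∩ S').Nonempty := by
    intro S hS S' hS' h1 h2
    by_cases hi : i ∈ S'
    · exact ⟨i, by simp [hi]⟩
    by_cases hj : j ∈ S'
    · have h3 : insert i (S'.erase j) ∈ F := by tauto
      obtain ⟨x, hx⟩ := h S hS _ h3
      simp only [mem_inter, mem_insert, mem_erase] at hx
      have hxi : x ≠ i := by rintro rfl; exact h1.2.1 hx.1
      refine ⟨x, ?_⟩
      simp only [mem_inter, mem_insert, mem_erase]
      tauto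
    · obtain ⟨x, hx⟩ := h S hS _ hS'
      simp only [mem_inter] at hx
      have hxj : x ≠ j := by rintro rfl; exact hj hx.2
      refine ⟨x, ?_⟩
      simp only [mem_inter, mem_insert, mem_erase]
      tauto
  intro A hA B hB
  obtain ⟨S, hS, rfl⟩ := mem_image.1 hA
  obtain ⟨S', hS', rfl⟩ := mem_image.1 hB
  unfold mvs
  split_ifs with h1 h2 h2
  · exact ⟨i, by simp⟩
  · exact key S hS S' hS' h1 h2
  · rw [inter_comm]
    exact key S' hS' S hS h2 h1
  · exact h S hS S' hS'

lemma sum_mvs_le {i j : ℕ} {F : Finset (Finset ℕ)} (ω : ℕ → ℕ) (h : ω i < ω j) (S : Finset ℕ) :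
    ∑ y ∈ mvs i j F S, ω y ≤ ∑ y ∈ S, ω y ∧
    ((j ∈ S ∧ i ∉ S ∧ insert i (S.erase j) ∉ F) → ∑ y ∈ mvs i j F S, ω y < ∑ y ∈ S, ω y) := by
  unfold mvs
  split_ifs with h1
  · have := add_sum_erase S ω h1.1
    rw [sum_insert (by simp [h1.2.1])]
    exact ⟨by omega, fun _ => by omega⟩
  · exact ⟨le_rfl, fun hh => absurd hh h1⟩

lemma exists_stable (P : Finset (Finset ℕ) → Prop) (rel : ℕ → ℕ → Prop) (ω : ℕ → ℕ)
    (hω : ∀ i j, rel i j → ω i < ω j)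
    (hP : ∀ F i j, rel i j → P F → P (shf i j F)) (F : Finset (Finset ℕ)) (hF : P F) :
    ∃ F', P F' ∧ ∀ i j, rel i j → ∀ S ∈ F', j ∈ S → i ∉ S → insert i (S.erase j) ∈ F' := by
  induction hm : ∑ S ∈ F, ∑ y ∈ S, ω y using Nat.strong_induction_on generalizing F with
  | _ m ih =>
    by_cases hst : ∀ i j, rel i j → ∀ S ∈ F, j ∈ S → i ∉ S → insert i (S.erase j) ∈ F
    · exact ⟨F, hF, hst⟩
    push Not at hst
    obtain ⟨i, j, hij, S, hS, hjS, hiS, hn⟩ := hst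
    refine ih _ ?_ (shf i j F) (hP F i j hij hF) rfl
    rw [← hm, shf, sum_image (mvs_injOn i j F)]
    exact sum_lt_sum (fun S _ => (sum_mvs_le ω (hω i j hij) S).1)
      ⟨S, hS, (sum_mvs_le ω (hω i j hij) S).2 ⟨hjS, hiS, hn⟩⟩


lemma bin_rel (e q : ℕ) : (e + 1) * (e+q).choose (e+1) = q * (e+q).choose e := by
  have := Nat.choose_succ_right_eq (e+q) e
  rw [show e + q - e = q by omega] at this
  linarith

lemma bin_pos (e q : ℕ) : 0 < (e+q).choose e := Nat.choose_pos (by omega)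

lemma k1' {e q : ℕ} {X : Finset ℕ} {𝒜 : Finset (Finset ℕ)} (hX : #X = e + q + 2)
    (h : 𝒜 ⊆ powersetCard q X) (heq : e + 1 ≤ q) (hc : #𝒜 ≤ (e+q).choose e) :
    q * #𝒜 ≤ (e + 1) * #(shd (e+1) 𝒜) := by
  have hsy : (e+q).choose q = (e+q).choose e := Nat.choose_symm_of_eq_add (by omega)
  have := k1 (M := e + q) h heq (by omega) (by rw [hsy]; exact hc)
  rw [hsy] at this
  have h1 := bin_rel e q
  apply Nat.le_of_mul_le_mul_right _ (bin_pos e q)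
  calc q * #𝒜 * (e+q).choose e = (#𝒜 * (e+q).choose (e+1)) * (e+1) := by
        rw [mul_assoc #𝒜, mul_comm _ (e+1), h1]; ring
    _ ≤ (#(shd (e+1) 𝒜) * (e+q).choose e) * (e+1) := Nat.mul_le_mul_right _ this
    _ = _ := by ring

lemma k2' {e q : ℕ} {X : Finset ℕ} {𝒜 : Finset (Finset ℕ)} (hX : #X = e + q + 2)
    (h : 𝒜 ⊆ powersetCard q X) (heq : e + 1 ≤ q) (he : 1 ≤ e + q) (hc : (e+q).choose e ≤ #𝒜)
    (hc2 : #𝒜 ≤ (e+q).choose e + (e+q).choose (e+1)) :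
    (e+q).choose (e+1) ≤ #(shd (e+1) 𝒜) ∧
    (#𝒜 - (e+q).choose e) * (e+q).choose e ≤
      (#(shd (e+1) 𝒜) - (e+q).choose (e+1)) * (e+q).choose (e+1) := by
  have hsy : (e+q).choose q = (e+q).choose e := Nat.choose_symm_of_eq_add (by omega)
  constructor
  · exact lovasz (M := e + q) h heq (by omega) (by omega) (by rw [hsy]; exact hc)
  · obtain ⟨r, rfl⟩ : ∃ r, q = r + 1 := ⟨q - 1, by omega⟩
    have hsy2 : (e+(r+1)).choose r = (e+(r+1)).choose (e+1) := Nat.choose_symm_of_eq_add (by omega)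
    rcases Nat.eq_zero_or_pos e with rfl | hepos
    · have hsy' := hsy
      have h3 : (0 + (r+1)+1).choose (r+1) = (0+(r+1)).choose r + (0+(r+1)).choose (r+1) :=
        Nat.choose_succ_succ _ _
      have := k2 (M := 0 + (r+1)) (s := 0) h (by omega) (by omega) (by omega)
        (by rw [hsy]; exact hc) (by rw [h3, hsy, hsy2, add_comm]; exact hc2)
      rw [hsy, hsy2] at this
      exact this
    · have h3 : (e + (r+1)+1).choose (r+1) = (e+(r+1)).choose r + (e+(r+1)).choose (r+1) :=
        Nat.choose_succ_succ _ _
      have := k2 (M := e + (r+1)) (s := e) h (by omega) (by omega) (by omega)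
        (by rw [hsy]; exact hc) (by rw [h3, hsy, hsy2, add_comm]; exact hc2)
      rw [hsy, hsy2] at this
      exact this

/-- the numerical condition -/
lemma hyp_of (k a t : ℕ) (hk : 3 ≤ k) (ha : 2 ≤ a) (hak : a ≤ k) (ht : t = (8 * k + 2) / 3) :
    (a = 3 ∧ t = 8) ∨ (a = 4 ∧ t = 11) ∨
    (2 * a + 1 ≤ t ∧ ((t:ℤ)-2)^2 ≤ a * (t - 2 * a) * (t - 1 - a)) := by
  have h3 : 8 * k ≤ 3 * t := by omega
  by_cases h7 : 7 ≤ a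
  · right; right
    refine ⟨by omega, ?_⟩
    obtain ⟨c, rfl⟩ : ∃ c, a = 7 + c := ⟨a - 7, by omega⟩
    obtain ⟨f, hf⟩ : ∃ f, 3 * t = 8 * (7 + c) + f := ⟨3 * t - 8 * (7 + c), by omega⟩
    have hf' : (3:ℤ) * t = 8 * (7 + c) + f := by exact_mod_cast hf
    have hc : (0:ℤ) ≤ c := by positivity
    have hff : (0:ℤ) ≤ f := by positivity
    have e1 : 9 * ((t:ℤ)-2)^2 = (3 * t - 6)^2 := by ring
    have e2 : 9 * (((7 + c : ℕ):ℤ) * (t - 2 * ((7 + c : ℕ):ℤ)) * (t - 1 - ((7 + c : ℕ):ℤ))) =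
      (7 + c) * (3 * t - 6 * (7 + c)) * (3 * t - 3 - 3 * (7 + c)) := by push_cast; ring
    have : 9 * ((t:ℤ)-2)^2 ≤ 
       9 * (((7 + c : ℕ):ℤ) * (t - 2 * ((7 + c : ℕ):ℤ)) * (t - 1 - ((7 + c : ℕ):ℤ))) := by
      rw [e1, e2, hf', ← sub_nonneg]
      ring_nf
      positivity
    linarith
  · have : a = 2 ∨ a = 3 ∨ a = 4 ∨ a = 5 ∨ a = 6 := by omega
    rcases this with rfl | rfl | rfl | rfl | rfl
    · right; right
      refine ⟨by omega, ?_⟩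
      have : (8:ℤ) ≤ t := by omega
      push_cast; nlinarith
    · by_cases h8 : t = 8
      · left; exact ⟨rfl, h8⟩
      · right; right
        refine ⟨by omega, ?_⟩
        have : 4 ≤ k := by
          rcases Nat.lt_or_ge k 4 with h | h
          · interval_cases k; omega
          · exact h
        have : (11:ℤ) ≤ t := by omega
        push_cast; nlinarith
    · by_cases h8 : t = 11
      · right; left; exact ⟨rfl, h8⟩
      · right; right
        refine ⟨by omega, ?_⟩
        have : 5 ≤ k := by
          rcases Nat.lt_or_ge k 5 with h | h
          · interval_cases k; omega
          · exact h
        have : (14:ℤ) ≤ t := by omega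
        push_cast; nlinarith
    · right; right
      refine ⟨by omega, ?_⟩
      have : (14:ℤ) ≤ t := by omega
      push_cast; nlinarith
    · right; right
      refine ⟨by omega, ?_⟩
      have : (16:ℤ) ≤ t := by omega
      push_cast; nlinarith

/-- conclusion of the numerics. Here a = e+2, N = e+q+2. -/
def Excl (e q h : ℕ) : Prop :=
  (∀ (X : Finset ℕ) (𝒜 : Finset (Finset ℕ)), #X = e + q + 2 → 𝒜 ⊆ powersetCard q X →
    h < #𝒜 → #𝒜 ≤ h + (e+q).choose e →
    (e+q).choose e + (e+q).choose (e+1) + (e+2) * #𝒜 ≤ (e+2) * #(shd (e+1) 𝒜)) ∧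
  (∀ u v, q * u ≤ (e+1) * v → (e+2) * v < (e+q).choose e + (e+q).choose (e+1) + (e+2) * u →
    u ≤ h + (e+q).choose e) ∧
  (∀ u f, u ≤ h → (e+2) * f < (e+q).choose e + (e+q).choose (e+1) →
    f + u < (e+q).choose (e+1))

lemma excl_gen (e q d : ℕ) (hd : q = e + 1 + d) (hd1 : 1 ≤ d)
    (hyp : (e + 1 + q)^2 ≤ (e + 2) * d * q) : ∃ h, Excl e q h := by
  have hrel := bin_rel e q
  have hbpos := bin_pos e q
  have hk1 := @k1' e q
  have hk2 := @k2' e q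
  unfold Excl
  generalize (e+q).choose e = b at *
  generalize (e+q).choose (e+1) = c at *
  have hD : 0 < (e+2) * d := by positivity
  have hq : 0 < q := by omega
  refine ⟨b * (e + 1 + q) / ((e+2) * d), ?_, ?_, ?_⟩
  all_goals
    generalize hh : b * (e + 1 + q) / ((e+2) * d) = h'
  all_goals
    have hle : h' * ((e+2) * d) ≤ b * (e + 1 + q) := by rw [← hh]; exact Nat.div_mul_le_self _ _
    have hlt : ∀ u, u * ((e+2) * d) ≤ b * (e + 1 + q) → u ≤ h' := fun u hu => by
      rw [← hh]; exact (Nat.le_div_iff_mul_le hD).2 hu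
    have hii : ∀ u v, q * u ≤ (e+1) * v → (e+2) * v < b + c + (e+2) * u → u ≤ h' := by
      intro u v h1 h2
      apply hlt
      have h3 : (e+1) * ((e+2) * v) < (e+1) * (b + c + (e+2) * u) :=
        Nat.mul_lt_mul_of_pos_left h2 (by omega)
      subst hd
      nlinarith
  · intro X 𝒜 hX hA h1 h2
    by_contra hcon
    push Not at hcon
    rcases le_total (#𝒜) b with hb | hb
    · have := hii _ _ (hk1 hX hA (by omega) hb) hcon
      omega
    · have hhc : h' ≤ c := by
        have : (e+1) * (h' * ((e+2) * d)) ≤ (e+1) * (c * ((e+2) * d)) := by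
          calc _ ≤ (e+1) * (b * (e + 1 + q)) := Nat.mul_le_mul_left _ hle
            _ ≤ b * (e+1+q)^2 := by nlinarith [Nat.zero_le (b * q * (e+1+q))]
            _ ≤ b * ((e + 2) * d * q) := Nat.mul_le_mul_left _ hyp
            _ = (q * b) * ((e+2) * d) := by ring
            _ = _ := by rw [← hrel]; ring
        have := Nat.le_of_mul_le_mul_left this (by omega)
        exact Nat.le_of_mul_le_mul_right this hD
      obtain ⟨hv, h3⟩ := hk2 hX hA (by omega) (by omega) hb (by omega)
      obtain ⟨w, hw⟩ : ∃ w, #𝒜 = b + w := ⟨#𝒜 - b, by omega⟩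
      obtain ⟨y, hy⟩ : ∃ y, #(shd (e+1) 𝒜) = c + y := ⟨#(shd (e+1) 𝒜) - c, by omega⟩
      rw [hw, hy] at hcon
      rw [hw, hy, Nat.add_sub_cancel_left, Nat.add_sub_cancel_left] at h3
      have hwh : w ≤ h' := by omega
      have hw2 : w * ((e+2) * d) ≤ b * (e + 1 + q) := (Nat.mul_le_mul_right _ hwh).trans hle
      -- w b ≤ y c,  (e+2)(c+y) < b + c + (e+2)(b+w)
      -- replace by multiples of q : (e+1) c = q b, so w (e+1) ≤ y q
      have h4 : w * (e+1) ≤ y * q := by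
        have : (w * (e+1)) * b ≤ (y * q) * b := by
          calc _ = (w * b) * (e+1) := by ring
            _ ≤ (y * c) * (e+1) := Nat.mul_le_mul_right _ h3
            _ = y * ((e+1) * c) := by ring
            _ = _ := by rw [hrel]; ring
        exact Nat.le_of_mul_le_mul_right this hbpos
      zify at hcon hw2 h4 hrel hyp
      have hd' : (d:ℤ) = q - e - 1 := by rw [hd]; push_cast; ring
      -- (e+2)(c - b + y - w) < b + c ; multiply by q(e+1)
      have h5 : ((e:ℤ)+2) * (c + y) * (q * (e+1)) < (b + c + (e+2) * (b + w)) * (q * (e+1)) :=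
        mul_lt_mul_of_pos_right hcon (by positivity)
      have h6 : ((e:ℤ)+2) * (e+1) * (w * (e+1)) ≤ (e+2) * (e+1) * (y * q) :=
        mul_le_mul_of_nonneg_left h4 (by positivity)
      -- (e+1) c = q b
      have h7 : ((e:ℤ)+2) * (c) * (q * (e+1)) = (e+2) * q * (q * b) := by rw [← hrel]; ring
      have h8 : (b + c + ((e:ℤ)+2) * (b + w)) * (q * (e+1)) =
        q * (b * (e+1) + q * b + (e+2) * (b + w) * (e+1)) := by rw [← hrel]; ring
      -- so (e+2) q² b + (e+2)(e+1)² w < q b(e+1+q) + q (e+2)(e+1)(b+w)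
      have h9 : ((e:ℤ)+2) * q * (q * b) + (e+2) * (e+1) * (w * (e+1)) <
         q * (b * (e+1) + q * b + (e+2) * (b + w) * (e+1)) := by
        rw [← h7, ← h8]; linarith
      have h10 : ((e:ℤ)+1) * (w * ((e+2) * d)) ≤ (e+1) * (b * (e+1+q)) :=
        mul_le_mul_of_nonneg_left hw2 (by positivity)
      have h11 : (b:ℤ) * (e+1+q)^2 ≤ b * ((e+2) * d * q) :=
        mul_le_mul_of_nonneg_left hyp (by positivity)
      rw [hd'] at h10 h11
      linarith
  · intro u v h1 h2
    exact (hii u v h1 h2).trans (by omega)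
  · intro u f hu hf
    have h1 : u * ((e+2) * d) ≤ b * (e + 1 + q) := (Nat.mul_le_mul_right _ hu).trans hle
    have h2 : d * ((e+2) * f) < d * (b + c) := Nat.mul_lt_mul_of_pos_left hf hd1
    have h3 : e + 1 + q ≤ (e+2) * d := by
      have : (e+1+q) * (e+1+q) ≤ ((e+2) * d) * (e+1+q) := by nlinarith [Nat.zero_le ((e+2)*d*(e+1))]
      exact Nat.le_of_mul_le_mul_right this (by omega)
    have h4 : (e+1) * (d * (b+c) + b * (e+1+q)) ≤ (e+1) * (((e+2) * d) * c) := by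
      calc (e+1) * (d * (b+c) + b * (e+1+q))
          = d * (b * (e+1) + (e+1) * c) + b * (e+1) * (e+1+q) := by ring
        _ = (q * b) * (e+1+q) := by rw [hrel, hd]; ring
        _ ≤ (q * b) * ((e+2) * d) := Nat.mul_le_mul_left _ h3
        _ = _ := by rw [← hrel]; ring
    have h5 := Nat.le_of_mul_le_mul_left h4 (by omega)
    by_contra hcon
    push Not at hcon
    have := Nat.mul_le_mul_left ((e+2) * d) hcon
    nlinarith

lemma excl_38 : Excl 1 4 1 := by
  refine ⟨?_, ?_, ?_⟩
  · intro X 𝒜 hX hA h1 h2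
    have c1 : (1+4).choose 1 = 5 := rfl
    have c2 : (1+4).choose (1+1) = 10 := rfl
    rw [c1] at h2 ⊢
    rw [c2]
    rcases le_or_gt (#𝒜) 5 with h5 | h5
    · have := k2 (M := 4) (r := 3) (s := 1) hA (by omega) (by omega) (by omega)
        (by rw [show Nat.choose 4 (3+1) = 1 from rfl]; omega) (by simp [Nat.choose]; omega)
      rw [show Nat.choose 4 (3+1) = 1 from rfl, show Nat.choose 4 1 = 4 from rfl, 
        show Nat.choose 4 (1+1) = 6 from rfl, show Nat.choose 4 3 = 4 from rfl] at this
      have l := lovasz (M := 4) (s := 2) hA (by omega) (by omega) (by omega) (by rw [show Nat.choose 4 4 = 1 from rfl]; omega)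
      rw [show Nat.choose 4 2 = 6 from rfl] at l
      have e0 : shd (1+1) 𝒜 = shd 2 𝒜 := rfl
      rw [e0] at this ⊢
      omega
    · have := k2' (e := 1) (q := 4) hX hA (by omega) (by omega) (by rw [c1]; omega) 
        (by rw [c1, c2]; omega)
      rw [c1, c2] at this
      omega
  · intro u v h1 h2
    simp [Nat.choose] at *
    omega
  · intro u f h1 h2
    simp [Nat.choose] at *
    omega

lemma excl_411 : Excl 2 6 14 := by
  have c1 : (2+6).choose 2 = 28 := rfl
  have c2 : (2+6).choose (2+1) = 56 := rfl
  have c3 : (7).choose 6 = 7 := rfl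
  have c4 : (7+1).choose 6 = 28 := rfl
  have c5 : (7).choose 2 = 21 := rfl
  have c6 : (7).choose 3 = 35 := rfl
  have c7 : (7).choose 5 = 21 := rfl
  refine ⟨?_, ?_, ?_⟩
  · intro X 𝒜 hX hA h1 h2
    rw [c1] at h2 ⊢
    rw [c2]
    rcases le_or_gt (#𝒜) 28 with h5 | h5
    · have := k2 (M := 7) (r := 5) (s := 2) hA (by omega) (by omega) (by omega)
        (by rw [c3]; omega) (by rw [c4]; omega)
      have l := lovasz (M := 7) (s := 3) hA (by omega) (by omega) (by omega) (by rw [c3]; omega)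
      rw [c6] at l
      have e0 : shd (2+1) 𝒜 = shd 3 𝒜 := rfl
      have c3' : (7).choose (5+1) = 7 := rfl
      have c6' : (7).choose (2+1) = 35 := rfl
      rw [e0] at this ⊢
      rw [c3', c5, c6', c7] at this
      omega
    · have := k2' (e := 2) (q := 6) hX hA (by omega) (by omega) (by rw [c1]; omega) 
        (by rw [c1, c2]; omega)
      rw [c1, c2] at this
      omega
  · intro u v h1 h2
    rw [c1, c2] at h2
    rw [c1]
    omega
  · intro u f h1 h2
    rw [c1, c2] at h2
    rw [c2]
    omega

lemma exists_excl (k e q : ℕ) (hk : 3 ≤ k) (hak : e + 2 ≤ k) (ht : e + q + 3 = (8 * k + 2) / 3) :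
    ∃ h, Excl e q h := by
  rcases hyp_of k (e+2) (e+q+3) hk (by omega) hak ht with ⟨h1, h2⟩ | ⟨h1, h2⟩ | ⟨h1, h2⟩
  · obtain rfl : e = 1 := by omega
    obtain rfl : q = 4 := by omega
    exact ⟨_, excl_38⟩
  · obtain rfl : e = 2 := by omega
    obtain rfl : q = 6 := by omega
    exact ⟨_, excl_411⟩
  · obtain ⟨d, rfl⟩ : ∃ d, q = e + 1 + d := ⟨q - (e+1), by omega⟩
    refine excl_gen e _ d rfl (by omega) ?_
    zify
    push_cast at h2
    calc _ = (((e:ℤ) + (e + 1 + d) + 3) - 2)^2 := by ring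
      _ ≤ _ := h2
      _ = _ := by ring


/-- complements -/
def cmpl (X : Finset ℕ) (𝒜 : Finset (Finset ℕ)) : Finset (Finset ℕ) := 𝒜.image (fun A => X \ A)

lemma cmpl_subset {X : Finset ℕ} {𝒜 : Finset (Finset ℕ)} {a r : ℕ} (h : 𝒜 ⊆ powersetCard a X)
    (hr : #X = r + a) : cmpl X 𝒜 ⊆ powersetCard r X := by
  intro B hB
  obtain ⟨A, hA, rfl⟩ := mem_image.1 hB
  have := mem_powersetCard.1 (h hA)
  rw [mem_powersetCard, card_sdiff_of_subset this.1, this.2]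
  exact ⟨sdiff_subset, by omega⟩

lemma card_cmpl {X : Finset ℕ} {𝒜 : Finset (Finset ℕ)} {a : ℕ} (h : 𝒜 ⊆ powersetCard a X) :
    #(cmpl X 𝒜) = #𝒜 := by
  apply card_image_of_injOn
  intro A hA B hB he
  have hA := (mem_powersetCard.1 (h hA)).1
  have hB := (mem_powersetCard.1 (h hB)).1
  have := congrArg (fun Z => X \ Z) he
  simpa [inter_eq_right.2 hA, inter_eq_right.2 hB] using this

lemma cross {X : Finset ℕ} {𝒜 𝒞 : Finset (Finset ℕ)} {s : ℕ}
    (h' : 𝒞 ⊆ powersetCard s X) (hc : ∀ A ∈ 𝒜, ∀ C ∈ 𝒞, (A ∩ C).Nonempty) :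
    #𝒞 + #(shd s (cmpl X 𝒜)) ≤ (#X).choose s := by
  have hsub : shd s (cmpl X 𝒜) ⊆ powersetCard s X := by
    intro B hB
    obtain ⟨A, hA, hBA, hc⟩ := mem_shd.1 hB
    obtain ⟨A', hA', rfl⟩ := mem_image.1 hA
    exact mem_powersetCard.2 ⟨hBA.trans sdiff_subset, hc⟩
  rw [← card_powersetCard, ← card_union_of_disjoint]
  · exact card_le_card (union_subset h' hsub)
  · rw [disjoint_left]
    intro C hC hC'
    obtain ⟨A, hA, hBA, -⟩ := mem_shd.1 hC'
    obtain ⟨A', hA', rfl⟩ := mem_image.1 hA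
    obtain ⟨x, hx⟩ := hc A' hA' C hC
    rw [mem_inter] at hx
    exact (mem_sdiff.1 (hBA hx.2)).2 hx.1

lemma nonMember_subset {T : Finset ℕ} {G : Finset (Finset ℕ)} {m x : ℕ}
    (h : G ⊆ powersetCard m T) : G.nonMemberSubfamily x ⊆ powersetCard m (T.erase x) := by
  intro S hS
  rw [mem_nonMemberSubfamily] at hS
  have := mem_powersetCard.1 (h hS.1)
  exact mem_powersetCard.2 ⟨subset_erase.2 ⟨this.1, hS.2⟩, this.2⟩

lemma member_subset {T : Finset ℕ} {G : Finset (Finset ℕ)} {m x : ℕ}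
    (h : G ⊆ powersetCard (m+1) T) : G.memberSubfamily x ⊆ powersetCard m (T.erase x) := by
  intro S hS
  rw [mem_memberSubfamily] at hS
  have := mem_powersetCard.1 (h hS.1)
  rw [card_insert_of_notMem hS.2] at this
  exact mem_powersetCard.2 ⟨subset_erase.2 ⟨(subset_insert _ _).trans this.1, hS.2⟩, by omega⟩

lemma cross_level {T : Finset ℕ} {G₁ G₂ : Finset (Finset ℕ)} {s x : ℕ} (hx : x ∈ T)
    (h₂ : G₂ ⊆ powersetCard (s+1) T)
    (hc : ∀ A ∈ G₁, ∀ B ∈ G₂, (A ∩ B).Nonempty) :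
    #(G₂.memberSubfamily x) + #(shd s (cmpl (T.erase x) (G₁.nonMemberSubfamily x))) ≤
      (#T - 1).choose s := by
  rw [← card_erase_of_mem hx]
  apply cross (member_subset h₂)
  intro A hA C hC
  rw [mem_nonMemberSubfamily] at hA
  rw [mem_memberSubfamily] at hC
  obtain ⟨y, hy⟩ := hc A hA.1 _ hC.1
  rw [mem_inter, mem_insert] at hy
  refine ⟨y, mem_inter.2 ⟨hy.1, hy.2.resolve_left ?_⟩⟩
  rintro rfl
  exact hA.2 hy.1

lemma cross_ekr {Y : Finset ℕ} {P Q : Finset (Finset ℕ)} {e q : ℕ} (heq : e + 1 ≤ q)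
    (hY : #Y = e + q + 1) (hP : P ⊆ powersetCard (e+1) Y) (hQ : Q ⊆ powersetCard (e+1) Y)
    (hc : ∀ A ∈ P, ∀ B ∈ Q, (A ∩ B).Nonempty) :
    #P ≤ (e+q).choose e ∨ #Q ≤ (e+q).choose e := by
  by_contra hcon
  push Not at hcon
  have hsy : (e+q).choose q = (e+q).choose e := Nat.choose_symm_of_eq_add (by omega)
  have h1 := lovasz (M := e+q) (s := e+1) (r := q) (cmpl_subset hP (by omega)) heq (by omega) (by omega)
    (by rw [card_cmpl hP, hsy]; omega)
  have h2 := cross hQ hc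
  rw [hY, Nat.choose_succ_succ (e+q) e] at h2
  simp only [Nat.succ_eq_add_one] at h2
  omega

lemma center {T : Finset ℕ} {G : Finset (Finset ℕ)} {e q h : ℕ} (heq : e + 1 ≤ q)
    (hT : #T = e + q + 3) (hG : G ⊆ powersetCard (e+2) T)
    (hint : ∀ A ∈ G, ∀ B ∈ G, (A ∩ B).Nonempty) (hex : Excl e q h)
    (heavy : (e+2) * (e+q+2).choose (e+1) < 
      (e+q).choose e + (e+q).choose (e+1) + (e+2) * #G) :
    ∃ x ∈ T, (e+q+2).choose (e+1) < #(G.memberSubfamily x) + (e+q).choose (e+1) := by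
  obtain ⟨ex1, ex2, ex3⟩ := hex
  have hcr : ∀ G' : Finset (Finset ℕ), G' ⊆ powersetCard (e+2) T →
      (∀ A ∈ G', ∀ B ∈ G', (A ∩ B).Nonempty) → ∀ x ∈ T, #(G'.memberSubfamily x) +
        #(shd (e+1) (cmpl (T.erase x) (G'.nonMemberSubfamily x))) ≤ (e+q+2).choose (e+1) := by
    intro G' h1 h2 x hx
    have := cross_level hx h1 h2
    rwa [hT] at this
  have hv : ∀ G' : Finset (Finset ℕ), G' ⊆ powersetCard (e+2) T →
      (∀ A ∈ G', ∀ B ∈ G', (A ∩ B).Nonempty) → #G' = #G → ∀ x ∈ T, 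
      (e+2) * #(shd (e+1) (cmpl (T.erase x) (G'.nonMemberSubfamily x))) < 
      (e+q).choose e + (e+q).choose (e+1) + (e+2) * #(G'.nonMemberSubfamily x) := by
    intro G' h1 h2 h3 x hx
    have h4 := Nat.mul_le_mul_left (e+2) (hcr G' h1 h2 x hx)
    have h5 := card_memberSubfamily_add_card_nonMemberSubfamily x G'
    rw [h3] at h5
    rw [← h5] at heavy
    rw [mul_add] at heavy h4
    omega
  have hexcl : ∀ G' : Finset (Finset ℕ), G' ⊆ powersetCard (e+2) T →
      (∀ A ∈ G', ∀ B ∈ G', (A ∩ B).Nonempty) → #G' = #G → ∀ x ∈ T,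
      h < #(G'.nonMemberSubfamily x) → h + (e+q).choose e < #(G'.nonMemberSubfamily x) := by
    intro G' h1 h2 h3 x hx h4
    by_contra hcon
    push Not at hcon
    have hX : #(T.erase x) = e + q + 2 := by rw [card_erase_of_mem hx, hT]; omega
    have h5 := nonMember_subset (x := x) h1
    have := ex1 (T.erase x) (cmpl (T.erase x) (G'.nonMemberSubfamily x)) hX
      (cmpl_subset h5 (by omega)) (by rwa [card_cmpl h5]) (by rwa [card_cmpl h5])
    rw [card_cmpl h5] at this
    have := hv G' h1 h2 h3 x hx
    omega
  have main : ∃ x ∈ T, #(G.nonMemberSubfamily x) ≤ h + (e+q).choose e := by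
    by_contra hcon
    push Not at hcon
    obtain ⟨G', ⟨g1, g2, g3, g4⟩, gst⟩ := exists_stable
      (fun G' => G' ⊆ powersetCard (e+2) T ∧ (∀ A ∈ G', ∀ B ∈ G', (A ∩ B).Nonempty) ∧ #G' = #G ∧
        ∀ x ∈ T, h + (e+q).choose e < #(G'.nonMemberSubfamily x))
      (fun i j => i ∈ T ∧ j ∈ T ∧ i < j) id (fun i j hij => hij.2.2)
      (by
        rintro G' i j ⟨hi, hj, hij⟩ ⟨g1, g2, g3, g4⟩
        have s1 := shf_subset (j := j) hi g1
        have s2 := shf_int (i := i) (j := j) g2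
        have s3 : #(shf i j G') = #G := by rw [card_shf, g3]
        refine ⟨s1, s2, s3, ?_⟩
        intro x hx
        by_cases hxi : x = i
        · subst hxi
          apply hexcl _ s1 s2 s3 x hx
          have r1 : #((G'.nonMemberSubfamily x).nonMemberSubfamily j) ≤
              #((shf x j G').nonMemberSubfamily x) := by
            unfold nonMemberSubfamily
            rw [filter_filter]
            apply card_filter_shf_ge
            rintro S hS ⟨hxS, hjS⟩
            rwa [mvs_of_notMem hjS]
          refine lt_of_lt_of_le ?_ r1
          have r2 : (G'.nonMemberSubfamily x).nonMemberSubfamily j =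
            (G'.nonMemberSubfamily j).nonMemberSubfamily x := by
            unfold nonMemberSubfamily
            rw [filter_comm]
          have c1 := card_memberSubfamily_add_card_nonMemberSubfamily j (G'.nonMemberSubfamily x)
          have c2 := card_memberSubfamily_add_card_nonMemberSubfamily x (G'.nonMemberSubfamily j)
          rw [← r2] at c2
          have d1 := g4 x hx
          have d2 := g4 j hj
          have hjx : j ∈ T.erase x := mem_erase.2 ⟨by omega, hj⟩
          have hY : #((T.erase x).erase j) = e + q + 1 := by
            rw [card_erase_of_mem hjx, card_erase_of_mem hx, hT]; omega
          have := cross_ekr (Y := (T.erase x).erase j) heq hY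
            (P := (G'.nonMemberSubfamily x).memberSubfamily j)
            (Q := (G'.nonMemberSubfamily j).memberSubfamily x)
            (member_subset (nonMember_subset g1))
            (by rw [erase_right_comm]; exact member_subset (nonMember_subset g1))
            (by
              intro A hA B hB
              simp only [mem_memberSubfamily, mem_nonMemberSubfamily, mem_insert, not_or] at hA hB
              obtain ⟨y, hy⟩ := g2 _ hA.1.1 _ hB.1.1
              simp only [mem_inter, mem_insert] at hy
              refine ⟨y, mem_inter.2 ?_⟩
              obtain ⟨h1 | h1, h2 | h2⟩ := hy
              · omega
              · exact absurd (h1 ▸ h2) hB.1.2.2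
              · exact absurd (h2 ▸ h1) hA.1.2.2
              · exact ⟨h1, h2⟩)
          omega
        · refine lt_of_lt_of_le (g4 x hx) ?_
          unfold nonMemberSubfamily
          apply card_filter_shf_ge
          intro S hS hxS
          exact notMem_mvs_of_ne hxi hxS)
      G ⟨hG, hint, rfl, hcon⟩
    have hne : T.Nonempty := by rw [← card_pos]; omega
    obtain ⟨x, hx, hmin⟩ : ∃ x ∈ T, ∀ y ∈ T, x ≤ y :=
      ⟨T.min' hne, T.min'_mem hne, fun y hy => T.min'_le y hy⟩
    have hX : #(T.erase x) = e + q + 2 := by rw [card_erase_of_mem hx, hT]; omega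
    have hA := nonMember_subset (x := x) g1
    obtain ⟨σ, rfl⟩ : ∃ σ, q = e + 1 + σ := ⟨q - (e+1), by omega⟩
    have hK := lemmaK (T.erase x) e σ (cmpl (T.erase x) (G'.nonMemberSubfamily x))
      (cmpl_subset hA (by omega))
      (by
        intro S hS S' hS'
        obtain ⟨A, hA1, rfl⟩ := mem_image.1 hS
        obtain ⟨B, hB1, rfl⟩ := mem_image.1 hS'
        have hA2 := mem_powersetCard.1 (hA hA1)
        have hB2 := mem_powersetCard.1 (hA hB1)
        rw [mem_nonMemberSubfamily] at hA1 hB1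
        have h2 : 2 ≤ #(A ∩ B) := by
          by_contra hlt
          obtain ⟨y, hy⟩ := g2 A hA1.1 B hB1.1
          have hy' := mem_inter.1 hy
          have hyT := mem_erase.1 (hA2.1 hy'.1)
          have hsw := gst x y ⟨hx, hyT.2, lt_of_le_of_ne (hmin y hyT.2) hyT.1.symm⟩ A hA1.1 hy'.1 hA1.2
          obtain ⟨z, hz⟩ := g2 _ hsw B hB1.1
          simp only [mem_inter, mem_insert, mem_erase] at hz
          rcases hz with ⟨rfl | hz, hz'⟩
          · exact hB1.2 hz'
          · exact hz.1 (card_le_one.1 (by omega) z (mem_inter.2 ⟨hz.2, hz'⟩) y hy)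
        have h3 := card_union_add_card_inter A B
        have h4 : (T.erase x \ A) ∩ (T.erase x \ B) = T.erase x \ (A ∪ B) := by
          rw [sdiff_union_distrib]
        rw [h4, card_sdiff_of_subset (union_subset hA2.1 hB2.1), hX]
        omega)
      (by
        intro S hS i hi j hj hjS hij
        obtain ⟨B, hB1, rfl⟩ := mem_image.1 hS
        have hB2 := mem_powersetCard.1 (hA hB1)
        rw [mem_nonMemberSubfamily] at hB1
        have hi' := mem_sdiff.1 hi
        have hjB : j ∈ B := by
          by_contra hh
          exact hjS (mem_sdiff.2 ⟨hj, hh⟩)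
        have hsw := gst i j ⟨(mem_erase.1 hi'.1).2, (mem_erase.1 hj).2, hij⟩ B hB1.1 hjB hi'.2
        refine mem_image.2 ⟨insert i (B.erase j), ?_, ?_⟩
        · rw [mem_nonMemberSubfamily]
          refine ⟨hsw, ?_⟩
          simp only [mem_insert, mem_erase, not_or]
          exact ⟨(mem_erase.1 hi'.1).1.symm, fun hh => hB1.2 hh.2⟩
        · ext y
          simp only [mem_sdiff, mem_insert, mem_erase, not_or, not_and]
          have := mem_erase.1 hj
          have hij' : i ≠ j := by omega
          by_cases hyj : y = j
          · subst hyj; simp; tauto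
          · simp [hyj]; tauto)
    rw [card_cmpl hA] at hK
    have := ex2 _ _ hK (hv G' g1 g2 g3 x hx)
    have := g4 x hx
    omega
  obtain ⟨x, hx, hle⟩ := main
  have hle' : #(G.nonMemberSubfamily x) ≤ h := by
    by_contra hh
    have := hexcl G hG hint rfl x hx (by omega)
    omega
  refine ⟨x, hx, ?_⟩
  have hb := bin_pos e q
  have := ex3 _ ((e+q+2).choose (e+1) - #G) hle' (by
    rcases le_total ((e+q+2).choose (e+1)) #G with hh | hh
    · rw [Nat.sub_eq_zero_of_le hh]; omega
    · rw [Nat.mul_sub]; omega)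
  have h5 := card_memberSubfamily_add_card_nonMemberSubfamily x G
  omega


lemma trace_int {k : ℕ} {F : Finset (Finset ℕ)} {X T : Finset ℕ} (hF : F ⊆ powersetCard k X)
    (hT : 2 * k ≤ #T) (hint : ∀ A ∈ F, ∀ B ∈ F, (A ∩ B).Nonempty)
    (hst : ∀ y z, (y ∈ T ∧ z ∉ T) → ∀ S ∈ F, z ∈ S → y ∉ S → insert y (S.erase z) ∈ F) :
    ∀ A ∈ F, ∀ B ∈ F, ((A ∩ T) ∩ (B ∩ T)).Nonempty := by
  intro A hA B hB
  induction hm : #(A ∩ B) using Nat.strong_induction_on generalizing A with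
  | _ m ih =>
    obtain ⟨z, hz⟩ := hint A hA B hB
    have hz' := mem_inter.1 hz
    by_cases hzT : z ∈ T
    · exact ⟨z, by simp [hz'.1, hz'.2, hzT]⟩
    have h1 := card_union_add_card_inter A B
    rw [(mem_powersetCard.1 (hF hA)).2, (mem_powersetCard.1 (hF hB)).2] at h1
    have h2 : 0 < #(A ∩ B) := card_pos.2 ⟨z, hz⟩
    obtain ⟨y, hy, hyS⟩ := exists_mem_notMem_of_card_lt_card (show #(A ∪ B) < #T by omega)
    rw [mem_union, not_or] at hyS
    have h3 : insert y (A.erase z) ∩ B = (A ∩ B).erase z := by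
      ext x
      simp only [mem_inter, mem_insert, mem_erase]
      constructor
      · rintro ⟨rfl | hx, hx'⟩
        · exact absurd hx' hyS.2
        · exact ⟨hx.1, hx.2, hx'⟩
      · rintro ⟨hx, hx1, hx2⟩
        exact ⟨Or.inr ⟨hx, hx1⟩, hx2⟩
    obtain ⟨x, hx⟩ := ih _ (by rw [h3, card_erase_of_mem hz]; omega) _
      (hst y z ⟨hy, hzT⟩ A hA hz'.1 hyS.1) rfl
    simp only [mem_inter, mem_insert, mem_erase] at hx
    refine ⟨x, ?_⟩
    simp only [mem_inter]
    obtain ⟨⟨rfl | hx1, hx2⟩, hx3, hx4⟩ := hx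
    · exact absurd hx3 hyS.2
    · exact ⟨⟨hx1.2, hx2⟩, hx3, hx4⟩

/-- level `a` of the traces -/
def lev (F : Finset (Finset ℕ)) (T : Finset ℕ) (a : ℕ) : Finset (Finset ℕ) :=
  (F.image (fun A => A ∩ T)).filter (fun S => #S = a)

lemma lev_subset (F : Finset (Finset ℕ)) (T : Finset ℕ) (a : ℕ) : lev F T a ⊆ powersetCard a T := by
  intro S hS
  rw [lev, mem_filter, mem_image] at hS
  obtain ⟨⟨A, hA, rfl⟩, hc⟩ := hS
  exact mem_powersetCard.2 ⟨inter_subset_right, hc⟩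

lemma deg_sum {k : ℕ} {F : Finset (Finset ℕ)} {X T : Finset ℕ} (hF : F ⊆ powersetCard k X)
    (hTX : T ⊆ X) (x : ℕ) :
    ∑ y ∈ T.erase x, degree F y ≤
      ∑ a ∈ range (k+1), (#X - #T).choose (k - a) * ∑ S ∈ lev F T a, #(S.erase x) := by
  have h1 : ∑ y ∈ T.erase x, degree F y = ∑ A ∈ F, #((A ∩ T).erase x) := by
    simp only [degree, card_eq_sum_ones, sum_filter]
    rw [sum_comm]
    refine sum_congr rfl fun A _ => ?_
    rw [← sum_filter]
    refine sum_congr ?_ fun _ _ => rfl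
    ext y
    simp only [mem_filter, mem_erase, mem_inter]
    tauto
  have h2 : ∑ A ∈ F, #((A ∩ T).erase x) = ∑ S ∈ F.image (fun A => A ∩ T),
      #(F.filter (fun A => A ∩ T = S)) * #(S.erase x) := by
    rw [← sum_fiberwise_of_maps_to (g := fun A => A ∩ T) (t := F.image (fun A => A ∩ T))
      (fun A hA => mem_image_of_mem _ hA)]
    refine sum_congr rfl fun S _ => ?_
    rw [card_eq_sum_ones, sum_mul]
    refine sum_congr rfl fun A hA => ?_
    rw [mem_filter] at hA
    rw [hA.2, one_mul]
  have h3 : ∀ S ∈ F.image (fun A => A ∩ T), 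
      #(F.filter (fun A => A ∩ T = S)) ≤ (#X - #T).choose (k - #S) := by
    intro S hS
    rw [← card_sdiff_of_subset hTX, ← card_powersetCard]
    apply card_le_card_of_injOn (fun A => A \ T)
    · intro A hA
      simp only [coe_filter, Set.mem_ofPred_eq] at hA
      have hAX := mem_powersetCard.1 (hF hA.1)
      simp only [mem_coe, mem_powersetCard]
      refine ⟨sdiff_subset_sdiff hAX.1 le_rfl, ?_⟩
      have := card_sdiff_add_card_inter A T
      rw [hA.2] at this
      omega
    · intro A hA A' hA' he
      simp only [coe_filter, Set.mem_ofPred_eq] at hA hA'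
      simp only at he
      rw [← sdiff_union_inter A T, ← sdiff_union_inter A' T, he, hA.2, hA'.2]
  rw [h1, h2]
  calc _ ≤ ∑ S ∈ F.image (fun A => A ∩ T), (#X - #T).choose (k - #S) * #(S.erase x) :=
        sum_le_sum fun S hS => Nat.mul_le_mul_right _ (h3 S hS)
    _ = ∑ a ∈ range (k+1), ∑ S ∈ lev F T a, (#X - #T).choose (k - #S) * #(S.erase x) := by
        unfold lev
        rw [sum_fiberwise_of_maps_to]
        intro S hS
        obtain ⟨A, hA, rfl⟩ := mem_image.1 hS
        have := card_le_card (inter_subset_left (s₁ := A) (s₂ := T))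
        rw [(mem_powersetCard.1 (hF hA)).2] at this
        simp only [mem_range]
        omega
    _ = _ := by
        refine sum_congr rfl fun a _ => ?_
        rw [mul_sum]
        refine sum_congr rfl fun S hS => ?_
        rw [lev, mem_filter] at hS
        rw [hS.2]

lemma sum_erase_level {G : Finset (Finset ℕ)} {T : Finset ℕ} {m : ℕ}
    (hG : G ⊆ powersetCard (m+1) T) (x : ℕ) :
    ∑ S ∈ G, #(S.erase x) = (m+1) * #(G.nonMemberSubfamily x) + m * #(G.memberSubfamily x) := by
  rw [← sum_filter_add_sum_filter_not G (fun S => x ∈ S)]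
  have h1 : ∑ S ∈ G.filter (fun S => x ∈ S), #(S.erase x) = #(G.filter (fun S => x ∈ S)) * m := by
    rw [sum_const_nat]
    intro S hS
    rw [mem_filter] at hS
    rw [card_erase_of_mem hS.2, (mem_powersetCard.1 (hG hS.1)).2]
    omega
  have h2 : ∑ S ∈ G.filter (fun S => x ∉ S), #(S.erase x) =
      #(G.filter (fun S => x ∉ S)) * (m+1) := by
    rw [sum_const_nat]
    intro S hS
    rw [mem_filter] at hS
    rw [erase_eq_of_notMem hS.2, (mem_powersetCard.1 (hG hS.1)).2]
  have h3 := card_memberSubfamily_add_card_nonMemberSubfamily x G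
  have h4 : #(G.nonMemberSubfamily x) = #(G.filter (fun S => x ∉ S)) := rfl
  have h5 := card_filter_add_card_filter_not (s := G) (fun S => x ∈ S)
  have h6 : #(G.memberSubfamily x) = #(G.filter (fun S => x ∈ S)) := by omega
  rw [h1, h2, h6, h4]
  ring

lemma sum_erase_avg {G : Finset (Finset ℕ)} {T : Finset ℕ} {a : ℕ}
    (hG : G ⊆ powersetCard a T) :
    ∑ x ∈ T, ∑ S ∈ G, #(S.erase x) = a * (#T - 1) * #G := by
  rw [sum_comm]
  have : ∀ S ∈ G, ∑ x ∈ T, #(S.erase x) = a * (#T - 1) := by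
    intro S hS
    have hS' := mem_powersetCard.1 (hG hS)
    have : ∀ x ∈ T, #(S.erase x) = ∑ y ∈ S, if y ≠ x then 1 else 0 := by
      intro x _
      rw [card_eq_sum_ones, ← sum_filter]
      refine sum_congr ?_ fun _ _ => rfl
      ext y
      simp [and_comm]
    rw [sum_congr rfl this, sum_comm]
    have h2 : ∀ y ∈ S, (∑ x ∈ T, if y ≠ x then 1 else 0) = #T - 1 := by
      intro y hy
      rw [← sum_filter, ← card_eq_sum_ones, ← card_erase_of_mem (hS'.1 hy)]
      congr 1
      ext x
      simp [and_comm, eq_comm]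
    rw [sum_const_nat h2, hS'.2]
  rw [sum_const_nat this]
  ring

lemma vander (k m t : ℕ) (ht : 2 ≤ t) (hk : 2 ≤ k) :
    ∑ a ∈ range (k+1), m.choose (k - a) * ((a-1) * (t-1).choose (a-1)) =
      (t-1) * (m + t - 2).choose (k-2) := by
  obtain ⟨κ, rfl⟩ : ∃ κ, k = κ + 2 := ⟨k - 2, by omega⟩
  obtain ⟨τ, rfl⟩ : ∃ τ, t = τ + 2 := ⟨t - 2, by omega⟩
  rw [sum_range_succ', sum_range_succ']
  simp only [Nat.add_sub_cancel, Nat.zero_sub, zero_add, Nat.sub_self, zero_mul, mul_zero, add_zero]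
  rw [show m + (τ + 2) - 2 = τ + m by omega, Nat.add_choose_eq,
    Finset.Nat.sum_antidiagonal_eq_sum_range_succ_mk, mul_sum]
  refine sum_congr rfl fun i hi => ?_
  rw [mem_range] at hi
  have := Nat.add_one_mul_choose_eq τ i
  simp only [show i + 1 + 1 - 1 = i + 1 by omega, show τ + 2 - 1 = τ + 1 by omega,
    show κ + 2 - (i + 1 + 1) = κ - i by omega]
  rw [← mul_assoc (τ+1), this]
  ring

lemma heavy_of {e q g : ℕ} (h : (e+q+3) * ((e+1) * (e+q+2).choose (e+1)) < (e+2) * (e+q+2) * g) :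
    (e+2) * (e+q+2).choose (e+1) < (e+q).choose e + (e+q).choose (e+1) + (e+2) * g := by
  have h1 : (e+q).choose e + (e+q).choose (e+1) = (e+q+1).choose (e+1) :=
    (Nat.choose_succ_succ (e+q) e).symm
  have h2 : (e+q+2) * (e+q+1).choose (e+1) = (q+1) * (e+q+2).choose (e+1) := by
    have := Nat.choose_mul_succ_eq (e+q+1) (e+1)
    rw [show e + q + 1 + 1 - (e + 1) = q + 1 by omega] at this
    linarith
  rw [h1]
  apply Nat.lt_of_mul_lt_mul_left (a := e+q+2)
  nlinarith

lemma key {k : ℕ} (hk : 3 ≤ k) {F : Finset (Finset ℕ)} {X T : Finset ℕ}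
    (hF : F ⊆ powersetCard k X) (hTX : T ⊆ X) (hT : #T = (8 * k + 2) / 3)
    (hint : ∀ A ∈ F, ∀ B ∈ F, (A ∩ B).Nonempty)
    (hst : ∀ y z, (y ∈ T ∧ z ∉ T) → ∀ S ∈ F, z ∈ S → y ∉ S → insert y (S.erase z) ∈ F) :
    ∃ x ∈ T, ∑ y ∈ T.erase x, degree F y ≤ (#T - 1) * (#X - 2).choose (k - 2) := by
  have htr := trace_int hF (by omega) hint hst
  have hcr : ∀ a b, ∀ A ∈ lev F T a, ∀ B ∈ lev F T b, (A ∩ B).Nonempty := by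
    intro a b A hA B hB
    rw [lev, mem_filter, mem_image] at hA hB
    obtain ⟨⟨A, hA, rfl⟩, -⟩ := hA
    obtain ⟨⟨B, hB, rfl⟩, -⟩ := hB
    exact htr A hA B hB
  have hcard := card_le_card hTX
  suffices ∃ x ∈ T, ∑ a ∈ range (k+1), (#X - #T).choose (k - a) * ∑ S ∈ lev F T a, #(S.erase x) ≤
      ∑ a ∈ range (k+1), (#X - #T).choose (k - a) * ((a-1) * (#T-1).choose (a-1)) by
    obtain ⟨x, hx, h⟩ := this
    refine ⟨x, hx, (deg_sum hF hTX x).trans (h.trans ?_)⟩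
    rw [vander k _ _ (by omega) (by omega), show #X - #T + #T = #X by omega]
  -- a sufficient levelwise condition
  have lw : ∀ x ∈ T, (∀ m, m + 1 ≤ k →
      ∑ S ∈ lev F T (m+1), #(S.erase x) ≤ m * (#T-1).choose m) →
      ∃ x ∈ T, ∑ a ∈ range (k+1), (#X - #T).choose (k - a) * ∑ S ∈ lev F T a, #(S.erase x) ≤
      ∑ a ∈ range (k+1), (#X - #T).choose (k - a) * ((a-1) * (#T-1).choose (a-1)) := by
    intro x hx h
    refine ⟨x, hx, sum_le_sum fun a ha => Nat.mul_le_mul_left _ ?_⟩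
    rw [mem_range] at ha
    rcases a with _ | m
    · have : ∑ S ∈ lev F T 0, #(S.erase x) = 0 := by
        apply sum_eq_zero
        intro S hS
        rw [lev, mem_filter, card_eq_zero] at hS
        simp [hS.2]
      rw [this]; exact Nat.zero_le _
    · exact h m (by omega)
  by_cases h1 : (lev F T 1).Nonempty
  · -- a singleton trace
    obtain ⟨Z, hZ⟩ := h1
    obtain ⟨hZT, hZ1⟩ := mem_powersetCard.1 (lev_subset _ _ _ hZ)
    obtain ⟨z, rfl⟩ := card_eq_one.1 hZ1
    apply lw z (by simpa using hZT)
    intro m hm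
    have hn : (lev F T (m+1)).nonMemberSubfamily z = ∅ := by
      apply eq_empty_of_forall_notMem
      intro S hS
      rw [mem_nonMemberSubfamily] at hS
      obtain ⟨y, hy⟩ := hcr _ _ S hS.1 _ hZ
      rw [mem_inter, mem_singleton] at hy
      exact hS.2 (hy.2 ▸ hy.1)
    rw [sum_erase_level (lev_subset _ _ _), hn]
    have := card_le_card (member_subset (x := z) (lev_subset F T (m+1)))
    rw [card_powersetCard, card_erase_of_mem (by simpa using hZT)] at this
    simpa using Nat.mul_le_mul_left m this
  have h10 : lev F T 1 = ∅ := not_nonempty_iff_eq_empty.1 h1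
  by_cases hh : ∃ e, e + 2 ≤ k ∧
      #T * ((e+1) * (#T - 1).choose (e+1)) < (e+2) * (#T - 1) * #(lev F T (e+2))
  · obtain ⟨e, he, hheavy⟩ := hh
    obtain ⟨q, hq⟩ : ∃ q, #T = e + q + 3 := ⟨#T - (e+3), by omega⟩
    obtain ⟨h, hex⟩ := exists_excl k e q hk he (by omega)
    rw [hq, show e + q + 3 - 1 = e + q + 2 by omega] at hheavy
    obtain ⟨x, hx, hxc⟩ := center (by omega) hq (lev_subset F T (e+2)) (hcr _ _) hex
      (heavy_of hheavy)
    apply lw x hx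
    intro m hm
    rcases m with _ | e'
    · simp [h10]
    obtain ⟨q', hq'⟩ : ∃ q', e + q = e' + q' := ⟨e + q - e', by omega⟩
    have hX : #(T.erase x) = e' + q' + 2 := by rw [card_erase_of_mem hx, hq]; omega
    have hA := nonMember_subset (x := x) (lev_subset F T (e'+1+1))
    have hsub := cmpl_subset (r := q') hA (by omega)
    have hlt : #((lev F T (e'+1+1)).nonMemberSubfamily x) ≤ (e'+q').choose e' := by
      by_contra hcon
      push Not at hcon
      have hsy : (e'+q').choose q' = (e'+q').choose e' := Nat.choose_symm_of_eq_add (by omega)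
      have l := lovasz (M := e'+q') (s := e+1) hsub (by omega) (by omega) (by omega)
        (by rw [card_cmpl hA, hsy]; omega)
      have c := cross_level hx (lev_subset F T (e+1+1)) (hcr (e'+1+1) (e+1+1))
      rw [hq, show e + q + 3 - 1 = e + q + 2 by omega] at c
      rw [← hq'] at l
      have e0 : lev F T (e+1+1) = lev F T (e+2) := rfl
      rw [e0] at c
      omega
    have k1 := k1' hX hsub (by omega) (by rw [card_cmpl hA]; exact hlt)
    rw [card_cmpl hA] at k1
    have c := cross_level hx (lev_subset F T (e'+1+1)) (hcr (e'+1+1) (e'+1+1))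
    rw [sum_erase_level (lev_subset F T (e'+1+1))]
    have h2 : (e'+1+1) * #((lev F T (e'+1+1)).nonMemberSubfamily x) ≤
      q' * #((lev F T (e'+1+1)).nonMemberSubfamily x) := Nat.mul_le_mul_right _ (by omega)
    have h3 := Nat.mul_le_mul_left (e'+1) c
    rw [mul_add] at h3
    omega
  · push Not at hh
    by_contra hcon
    push Not at hcon
    have hne : T.Nonempty := by rw [← card_pos]; omega
    have := sum_lt_sum_of_nonempty hne hcon
    rw [sum_const, smul_eq_mul, sum_comm] at this
    refine absurd this (not_lt.2 ?_)
    rw [mul_sum]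
    refine sum_le_sum fun a ha => ?_
    rw [mem_range] at ha
    rw [← mul_sum, sum_erase_avg (lev_subset F T a), mul_left_comm (#T)]
    apply Nat.mul_le_mul_left
    rcases a with _ | _ | e
    · simp
    · simp [h10]
    · exact hh e (by omega)

lemma exists_top {n i d : ℕ} {F : Finset (Finset ℕ)} (hi : 1 ≤ i) (h : d < nthDegree n F i) :
    ∃ T ⊆ Icc 1 n, #T = i ∧ ∀ y ∈ T, d < degree F y := by
  have hc : i ≤ #((Icc 1 n).filter (fun y => d < degree F y)) := by
    set l := ((Icc 1 n).val.map (degree F)).sort (· ≥ ·) with hl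
    have hs : l.Pairwise (· ≥ ·) := Multiset.pairwise_sort _ _
    have hlen : i - 1 < l.length := by
      by_contra hcon
      unfold nthDegree at h
      rw [← hl, List.getD_eq_default _ _ (by omega)] at h
      omega
    have hget : d < l[i-1] := by
      unfold nthDegree at h
      rwa [← hl, List.getD_eq_getElem _ _ hlen] at h
    have hcount : i ≤ l.countP (fun v => decide (d < v)) := by
      have h1 : (l.take i).countP (fun v => decide (d < v)) = (l.take i).length := by
        rw [List.countP_eq_length]
        intro v hv
        obtain ⟨j, hj, rfl⟩ := List.mem_iff_getElem.1 hv
        rw [List.length_take] at hj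
        rw [List.getElem_take, decide_eq_true_eq]
        rcases Nat.lt_or_ge j (i-1) with hj' | hj'
        · have := List.pairwise_iff_getElem.1 hs j (i-1) (by omega) hlen hj'
          omega
        · have : j = i - 1 := by omega
          subst this
          exact hget
      have h2 := (List.take_sublist i l).countP_le (p := fun v => decide (d < v))
      rw [h1, List.length_take] at h2
      omega
    have h3 : l.countP (fun v => decide (d < v)) =
        ((Icc 1 n).val.map (degree F)).countP (fun v => d < v) := by
      rw [← Multiset.sort_eq ((Icc 1 n).val.map (degree F)) (· ≥ ·), Multiset.coe_countP]
    rw [h3, Multiset.countP_map] at hcount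
    exact hcount
  obtain ⟨T, hT, hc'⟩ := exists_subset_card_eq hc
  exact ⟨T, hT.trans (filter_subset _ _), hc', fun y hy => (mem_filter.1 (hT hy)).2⟩

theorem stmt_3 (n k : ℕ) (hk : 3 ≤ k) (hn : (8 * k + 2) / 3 ≤ n)
    (F : Finset (Finset ℕ)) (hF : F ⊆ Finset.powersetCard k (Finset.Icc 1 n))
    (hint : ∀ A ∈ F, ∀ B ∈ F, (A ∩ B).Nonempty) :
    nthDegree n F ((8 * k + 2) / 3) ≤ (n - 2).choose (k - 2) := by
  by_contra hcon
  push Not at hcon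
  obtain ⟨T, hTX, hT, hdeg⟩ := exists_top (by omega) hcon
  obtain ⟨F', ⟨f1, f2, f3⟩, hst⟩ := exists_stable
    (fun F' => F' ⊆ powersetCard k (Icc 1 n) ∧ (∀ A ∈ F', ∀ B ∈ F', (A ∩ B).Nonempty) ∧
      ∀ y ∈ T, (n - 2).choose (k - 2) < degree F' y)
    (fun i j => i ∈ T ∧ j ∉ T) (fun x => if x ∈ T then 0 else 1)
    (by rintro i j ⟨hi, hj⟩; simp [hi, hj])
    (by
      rintro F' i j ⟨hi, hj⟩ ⟨f1, f2, f3⟩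
      refine ⟨shf_subset (hTX hi) f1, shf_int f2, fun y hy => (f3 y hy).trans_le ?_⟩
      apply card_filter_shf_ge
      intro S _ hyS
      exact mem_mvs_of_ne (by rintro rfl; exact hj hy) hyS)
    F ⟨hF, hint, hdeg⟩
  obtain ⟨x, hx, hle⟩ := key hk f1 hTX hT f2 hst
  have hlt : ∑ y ∈ T.erase x, (n - 2).choose (k - 2) < ∑ y ∈ T.erase x, degree F' y := by
    apply sum_lt_sum_of_nonempty
    · rw [← card_pos, card_erase_of_mem hx]; omega
    · exact fun y hy => f3 y (mem_of_mem_erase hy)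
  rw [sum_const, smul_eq_mul, card_erase_of_mem hx] at hlt
  simp only [Nat.card_Icc, Nat.add_sub_cancel] at hle
  omega
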